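/- Let G be a finitely generated group with a finite generating set S, let g(p,t) = 1 − Σ_{n=1}^∞ (1−t)^{n−1}·P_p(|C| = n) be the walk-through function of (G,S), and let p_c be the critical probability of the Cayley graph of (G,S). Then for every p with 0 < p < p_c and every integer k ≥ 1, the sum Σ_{n=k+1}^∞ (n−1)(n−2)⋯(n−k)·P_p(|C| = n) is finite and the k-th one-sided derivative of the function t ↦ g(p,t) at t = 0 (taken within [0,1]) equals (−1)^{k+1}·Σ_{n=k+1}^∞ (n−1)(n−2)⋯(n−k)·P_p(|C| = n), which equals (−1)^{k+1}·E_p[(|C|−1)(|C|−2)⋯(|C|−k)]. -/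

import Mathlib

open MeasureTheory ENNReal

namespace Perc

/-- Percolation configurations on the edge set `E`: each edge is `true` (open) or
`false` (closed). -/
abbrev Config (E : Type*) := E → Bool

/-- `μ` is the Bernoulli product measure `P_p` with parameter `p` on `{0,1}^E`: the measure
of every finite cylinder event is the corresponding product.  (This determines `μ` uniquely
on the product σ-algebra, since cylinders form a π-system generating it.) -/
def IsBernoulli {E : Type*} (p : ℝ) (μ : Measure (Config E)) : Prop :=
  ∀ (F : Finset E) (σ : E → Bool),
    μ {ω | ∀ e ∈ F, ω e = σ e} =
      ∏ e ∈ F, ENNReal.ofReal (if σ e then p else 1 - p)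

variable {G ι : Type*} [Group G]

/-- In the Cayley graph of `G` with edge set `G × ι`, where the edge `(a, i)` joins `a` and
`a * f i` (the function `f : ι → G` lists the generators, with multiplicity), this says that
vertices `a` and `b` are joined by some open edge of the configuration `ω`. -/
def Step (f : ι → G) (ω : Config (G × ι)) (a b : G) : Prop :=
  ∃ i : ι, (ω (a, i) = true ∧ b = a * f i) ∨ (ω (b, i) = true ∧ a = b * f i)

/-- `x` and `y` are connected by a path of open edges (`x ↔ y`). -/
def Conn (f : ι → G) (ω : Config (G × ι)) (x y : G) : Prop :=
  Relation.ReflTransGen (Step f ω) x y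

/-- The open cluster `C` of the identity. -/
def cluster (f : ι → G) (ω : Config (G × ι)) : Set G :=
  {x | Conn f ω 1 x}

/-- The percolation function `θ`: the probability that the cluster of the identity is
infinite. -/
noncomputable def theta (f : ι → G) (μ : Measure (Config (G × ι))) : ℝ :=
  (μ {ω | (cluster f ω).Infinite}).toReal

/-- The expected cluster size `χ = E(|C|) ∈ [0,∞]` (where `|C| ∈ ℕ∞` is coerced
to `ℝ≥0∞`). -/
noncomputable def chi (f : ι → G) (μ : Measure (Config (G × ι))) : ℝ≥0∞ :=
  ∫⁻ ω, ((cluster f ω).encard : ℝ≥0∞) ∂μ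

/-- The critical probability `p_c = inf {p ∈ [0,1] | θ(p) > 0}`, with the convention
`p_c = 1` if `θ` vanishes on `[0,1]`; here `μ p` is the percolation measure at
parameter `p`. -/
noncomputable def pc (f : ι → G) (μ : ℝ → Measure (Config (G × ι))) : ℝ :=
  sInf ({p | p ∈ Set.Icc (0 : ℝ) 1 ∧ 0 < theta f (μ p)} ∪ {1})

/-- The word metric on `G` with respect to the generators `f i`: the length of a shortest
word in the generators and their inverses taking `x` to `y`.  (When the generators generate
`G`, this is the graph distance in the Cayley graph.) -/
noncomputable def wdist (f : ι → G) (x y : G) : ℕ :=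
  sInf {n : ℕ | ∃ l : List G, l.length = n ∧
    (∀ g ∈ l, (∃ i, f i = g) ∨ (∃ i, (f i)⁻¹ = g)) ∧ x * l.prod = y}

/-- Schonmann's critical point
`p_exp = sup {p ∈ [0,1] | ∃ c > 0, γ > 0, ∀ x y, P_p(x ↔ y) ≤ c·exp(-γ·dist(x,y))}`. -/
noncomputable def pexp (f : ι → G) (μ : ℝ → Measure (Config (G × ι))) : ℝ :=
  sSup {p | p ∈ Set.Icc (0 : ℝ) 1 ∧ ∃ c > 0, ∃ γ > 0, ∀ x y : G,
    (μ p {ω | Conn f ω x y}).toReal ≤ c * Real.exp (-γ * (wdist f x y : ℝ))}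

/-- The walk-through function `g(p,t) = 1 - ∑_{n≥1} (1-t)^{n-1} P_p(|C| = n)` of a Cayley
graph; here `μ` is the percolation measure at parameter `p`. -/
noncomputable def wt (f : ι → G) (μ : Measure (Config (G × ι))) (t : ℝ) : ℝ :=
  1 - ∑' n : ℕ, (1 - t) ^ n * (μ {ω | (cluster f ω).encard = ((n + 1 : ℕ) : ℕ∞)}).toReal

/-- The ball of radius `j`: all products of at most `j` elements of `S ∪ S⁻¹`. -/
def ball (S : Set G) (j : ℕ) : Set G :=
  {g | ∃ l : List G, l.length ≤ j ∧ (∀ x ∈ l, x ∈ S ∨ x⁻¹ ∈ S) ∧ l.prod = g}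

/-- The Cheeger constant `h = inf_K |∂K| / |K|`, the infimum over nonempty finite vertex
sets `K` of the number of edges `(a, i)` (joining `a` and `a * f i`) with exactly one
endpoint in `K`, divided by `|K|`. -/
noncomputable def cheeger (f : ι → G) : ℝ :=
  ⨅ K : {K : Finset G // K.Nonempty},
    (Nat.card {e : G × ι // Xor' (e.1 ∈ K.1) (e.1 * f e.2 ∈ K.1)} : ℝ) / (K.1.card : ℝ)

/-- The open cluster of the identity in the subgraph induced on the vertex set `V`: only
open edges with both endpoints in `V` may be used. -/
def clusterIn (f : ι → G) (V : Set G) (ω : Config (G × ι)) : Set G :=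
  {x | Relation.ReflTransGen (fun a b => Step f ω a b ∧ a ∈ V ∧ b ∈ V) 1 x}

/-- The generators of `G` given by a generating set `S` (one edge orbit per element
of `S`). -/
def setGens (S : Set G) : S → G := Subtype.val

/-- The generators of the free product `G₁ * G₂` given by the disjoint union `S₁ ⊔ S₂` of
generating sets, embedded via the canonical monomorphisms. -/
def coprodGens {G₁ G₂ : Type*} [Group G₁] [Group G₂] (S₁ : Set G₁) (S₂ : Set G₂) :
    S₁ ⊕ S₂ → Monoid.Coprod G₁ G₂ :=
  Sum.elim (fun s => Monoid.Coprod.inl (s : G₁)) (fun s => Monoid.Coprod.inr (s : G₂))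

/-- The generators of the free product `G₁ * ⋯ * G_n` given by the disjoint union
`S₁ ⊔ ⋯ ⊔ S_n` of generating sets, embedded via the canonical monomorphisms. -/
def coprodIGens {n : ℕ} {G : Fin n → Type*} [∀ i, Group (G i)] (S : ∀ i, Set (G i)) :
    (Σ i, S i) → Monoid.CoprodI G :=
  fun x => Monoid.CoprodI.of (x.2 : G x.1)

/-- The image of a list of syllables in the free product `G₁ * G₂`. -/
def sylProd {G₁ G₂ : Type*} [Group G₁] [Group G₂] (l : List (G₁ ⊕ G₂)) :
    Monoid.Coprod G₁ G₂ :=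
  (l.map (Sum.elim (fun g => Monoid.Coprod.inl g) (fun h => Monoid.Coprod.inr h))).prod

/-- The set `P₁` of nontrivial elements of `G₁ * G₂` whose normal form begins with a
nontrivial syllable of `G₁`: elements represented by a nonempty alternating product of
nontrivial syllables, the first syllable lying in `G₁`.  (Such a representation is the
normal form, which is unique.) -/
def beginsLeft {G₁ G₂ : Type*} [Group G₁] [Group G₂] (x : Monoid.Coprod G₁ G₂) : Prop :=
  ∃ l : List (G₁ ⊕ G₂), l ≠ [] ∧ (∀ a ∈ l, a ≠ Sum.inl 1 ∧ a ≠ Sum.inr 1) ∧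
    l.Chain' (fun a b => a.isLeft ≠ b.isLeft) ∧
    (∃ g : G₁, l.head? = some (Sum.inl g)) ∧ sylProd l = x

/-- The set `P₂` of nontrivial elements of `G₁ * G₂` whose normal form begins with a
nontrivial syllable of `G₂`. -/
def beginsRight {G₁ G₂ : Type*} [Group G₁] [Group G₂] (x : Monoid.Coprod G₁ G₂) : Prop :=
  ∃ l : List (G₁ ⊕ G₂), l ≠ [] ∧ (∀ a ∈ l, a ≠ Sum.inl 1 ∧ a ≠ Sum.inr 1) ∧
    l.Chain' (fun a b => a.isLeft ≠ b.isLeft) ∧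
    (∃ h : G₂, l.head? = some (Sum.inr h)) ∧ sylProd l = x

end Perc

namespace Perc

section BernoulliSum

variable {E : Type*}

/-- The expectation of `h ω` where the random subset `ω` of `F` contains each element of `F`
independently with probability `p`. -/
noncomputable def bernoulliSum (p : ℝ) (F : Finset E) (h : Finset E → ℝ) : ℝ :=
  ∑ σ ∈ F.powerset, p ^ σ.card * (1 - p) ^ (F.card - σ.card) * h σ

variable {p : ℝ} {F F₁ F₂ : Finset E} {h h' : Finset E → ℝ}

@[simp] theorem bernoulliSum_empty : bernoulliSum p ∅ h = h ∅ := by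
  simp [bernoulliSum]

theorem bernoulliSum_congr (hh : ∀ σ ⊆ F, h σ = h' σ) :
    bernoulliSum p F h = bernoulliSum p F h' :=
  Finset.sum_congr rfl fun σ hσ => by rw [hh σ (Finset.mem_powerset.1 hσ)]

theorem bernoulliSum_mono (hp : p ∈ Set.Icc (0 : ℝ) 1) (hh : ∀ σ ⊆ F, h σ ≤ h' σ) :
    bernoulliSum p F h ≤ bernoulliSum p F h' :=
  Finset.sum_le_sum fun σ hσ => mul_le_mul_of_nonneg_left (hh σ (Finset.mem_powerset.1 hσ))
    (mul_nonneg (pow_nonneg hp.1 _) (pow_nonneg (sub_nonneg.2 hp.2) _))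

theorem bernoulliSum_const (c : ℝ) : bernoulliSum p F (fun _ => c) = c := by
  rw [bernoulliSum, ← Finset.sum_mul, Finset.sum_pow_mul_eq_add_pow]
  simp

theorem bernoulliSum_eq_zero (hh : ∀ σ ⊆ F, h σ = 0) : bernoulliSum p F h = 0 :=
  (bernoulliSum_congr hh).trans (bernoulliSum_const 0)

theorem bernoulliSum_add :
    bernoulliSum p F (fun σ => h σ + h' σ) = bernoulliSum p F h + bernoulliSum p F h' := by
  simp [bernoulliSum, mul_add, Finset.sum_add_distrib]

theorem bernoulliSum_sub :
    bernoulliSum p F (fun σ => h σ - h' σ) = bernoulliSum p F h - bernoulliSum p F h' := by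
  simp [bernoulliSum, mul_sub, Finset.sum_sub_distrib]

theorem bernoulliSum_const_mul (c : ℝ) :
    bernoulliSum p F (fun σ => c * h σ) = c * bernoulliSum p F h := by
  rw [bernoulliSum, bernoulliSum, Finset.mul_sum]
  exact Finset.sum_congr rfl fun _ _ => by ring

theorem bernoulliSum_mul_const (c : ℝ) :
    bernoulliSum p F (fun σ => h σ * c) = bernoulliSum p F h * c := by
  simp_rw [mul_comm _ c]
  exact bernoulliSum_const_mul c

theorem bernoulliSum_sum {κ : Type*} (s : Finset κ) (g : κ → Finset E → ℝ) :
    bernoulliSum p F (fun σ => ∑ i ∈ s, g i σ) = ∑ i ∈ s, bernoulliSum p F (g i) := by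
  simp_rw [bernoulliSum, Finset.mul_sum]
  exact Finset.sum_comm

theorem bernoulliSum_nonneg (hp : p ∈ Set.Icc (0 : ℝ) 1) (hh : ∀ σ ⊆ F, 0 ≤ h σ) :
    0 ≤ bernoulliSum p F h := by
  simpa only [bernoulliSum_const] using bernoulliSum_mono (h := fun _ => 0) hp hh

theorem bernoulliSum_pow_card (z : ℝ) :
    bernoulliSum p F (fun σ => z ^ σ.card) = (1 + p * (z - 1)) ^ F.card := by
  have := Finset.sum_pow_mul_eq_add_pow (p * z) (1 - p) F
  rw [show 1 + p * (z - 1) = p * z + (1 - p) by ring, ← this, bernoulliSum]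
  refine Finset.sum_congr rfl fun σ _ => ?_
  rw [mul_pow]
  ring

variable [DecidableEq E]

theorem bernoulliSum_insert {e : E} (he : e ∉ F) :
    bernoulliSum p (insert e F) h =
      p * bernoulliSum p F (fun σ => h (insert e σ)) + (1 - p) * bernoulliSum p F h := by
  unfold bernoulliSum
  rw [Finset.sum_powerset_insert he, add_comm, Finset.mul_sum, Finset.mul_sum]
  congr 1
  · refine Finset.sum_congr rfl fun σ hσ => ?_
    have hσ := Finset.mem_powerset.1 hσ
    rw [Finset.card_insert_of_notMem he, Finset.card_insert_of_notMem fun h => he (hσ h),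
      Nat.add_sub_add_right, pow_succ]
    ring
  · refine Finset.sum_congr rfl fun σ hσ => ?_
    have hσ := Finset.card_le_card (Finset.mem_powerset.1 hσ)
    rw [Finset.card_insert_of_notMem he, Nat.succ_sub hσ, pow_succ]
    ring

theorem bernoulliSum_union (hd : Disjoint F₁ F₂) :
    bernoulliSum p (F₁ ∪ F₂) h =
      bernoulliSum p F₁ (fun σ => bernoulliSum p F₂ (fun τ => h (σ ∪ τ))) := by
  induction F₁ using Finset.induction_on generalizing h with
  | empty => simp
  | insert e F₁ he ih =>
    rw [Finset.disjoint_insert_left] at hd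
    rw [Finset.insert_union, bernoulliSum_insert (by simp [he, hd.1]), bernoulliSum_insert he,
      ih hd.2, ih hd.2]
    simp only [Finset.insert_union]

theorem bernoulliSum_of_subset (hF : F₁ ⊆ F) :
    bernoulliSum p F h =
      bernoulliSum p F₁ (fun σ => bernoulliSum p (F \ F₁) (fun τ => h (σ ∪ τ))) := by
  rw [← bernoulliSum_union Finset.disjoint_sdiff, Finset.union_sdiff_of_subset hF]

theorem bernoulliSum_marginal (hF : F₁ ⊆ F) (hh : ∀ σ ⊆ F, h σ = h' (σ ∩ F₁)) :
    bernoulliSum p F h = bernoulliSum p F₁ h' := by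
  rw [bernoulliSum_of_subset hF]
  refine bernoulliSum_congr fun σ hσ => ?_
  rw [← bernoulliSum_const (p := p) (F := F \ F₁) (h' σ)]
  refine bernoulliSum_congr fun τ hτ => ?_
  rw [hh _ (Finset.union_subset (hσ.trans hF) (hτ.trans Finset.sdiff_subset))]
  congr 1
  ext e
  have := @hτ e
  have := @hσ e
  simp only [Finset.mem_sdiff, Finset.mem_inter, Finset.mem_union] at *
  tauto

theorem bernoulliSum_mono_set (hp : p ∈ Set.Icc (0 : ℝ) 1) (hF : F₁ ⊆ F) (hm : Monotone h) :
    bernoulliSum p F₁ h ≤ bernoulliSum p F h := by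
  rw [bernoulliSum_of_subset hF]
  refine bernoulliSum_mono hp fun σ _ => ?_
  rw [← bernoulliSum_const (p := p) (F := F \ F₁) (h σ)]
  exact bernoulliSum_mono hp fun τ _ => hm Finset.subset_union_left

theorem bernoulliSum_mono_param {q : ℝ} (hp : p ∈ Set.Icc (0 : ℝ) 1) (hpq : p ≤ q) (hq : q ≤ 1)
    (hm : Monotone h) : bernoulliSum p F h ≤ bernoulliSum q F h := by
  induction F using Finset.induction_on generalizing h with
  | empty => simp
  | insert e F he ih =>
    rw [bernoulliSum_insert he, bernoulliSum_insert he]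
    have h1 := ih (h := fun σ => h (insert e σ)) fun σ τ hst => hm (Finset.insert_subset_insert e hst)
    have h2 := ih hm
    have h3 : bernoulliSum q F h ≤ bernoulliSum q F (fun σ => h (insert e σ)) :=
      bernoulliSum_mono ⟨hp.1.trans hpq, hq⟩ fun σ _ => hm (Finset.subset_insert e σ)
    nlinarith [mul_le_mul_of_nonneg_left h1 hp.1,
      mul_le_mul_of_nonneg_left h2 (sub_nonneg.2 hp.2),
      mul_nonneg (sub_nonneg.2 hpq) (sub_nonneg.2 h3)]

/-- Russo's formula. -/
theorem hasDerivAt_bernoulliSum (p : ℝ) (F : Finset E) (h : Finset E → ℝ) :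
    HasDerivAt (fun q => bernoulliSum q F h)
      (∑ e ∈ F, bernoulliSum p (F.erase e) (fun σ => h (insert e σ) - h σ)) p := by
  induction F using Finset.induction_on generalizing h with
  | empty => simpa using hasDerivAt_const p (h ∅)
  | insert e F he ih =>
    have key := ((hasDerivAt_id p).mul (ih fun σ => h (insert e σ))).add
      (((hasDerivAt_id p).const_sub 1).mul (ih h))
    refine (key.congr_deriv ?_).congr_of_eventuallyEq
      (Filter.Eventually.of_forall fun q => bernoulliSum_insert he)
    rw [Finset.sum_insert he, Finset.erase_insert he, bernoulliSum_sub]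
    have : ∀ e' ∈ F, bernoulliSum p ((insert e F).erase e') (fun σ => h (insert e' σ) - h σ) =
        p * bernoulliSum p (F.erase e') (fun σ => h (insert e (insert e' σ)) - h (insert e σ)) +
        (1 - p) * bernoulliSum p (F.erase e') (fun σ => h (insert e' σ) - h σ) := by
      intro e' he'
      have hne : e' ≠ e := fun h => he (h ▸ he')
      rw [Finset.erase_insert_of_ne hne.symm, bernoulliSum_insert (by simp [he])]
      simp only [Finset.insert_comm e' e]
    rw [Finset.sum_congr rfl this, Finset.sum_add_distrib, ← Finset.mul_sum, ← Finset.mul_sum]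
    simp only [id]
    ring

theorem bernoulliSum_erase_mul {e : E} (he : e ∈ F) :
    (1 - p) * bernoulliSum p (F.erase e) h =
      bernoulliSum p F (fun σ => if e ∈ σ then 0 else h σ) := by
  conv_rhs => rw [← Finset.insert_erase he]
  rw [bernoulliSum_insert (Finset.notMem_erase e F)]
  simp only [Finset.mem_insert_self, if_true, bernoulliSum_const, mul_zero, zero_add]
  congr 1
  refine bernoulliSum_congr fun σ hσ => ?_
  rw [if_neg fun h => Finset.notMem_erase e F (hσ h)]

theorem bernoulliSum_map {E' : Type*} [DecidableEq E'] (τ : E ↪ E') (g : Finset E' → ℝ) :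
    bernoulliSum p (F.map τ) g = bernoulliSum p F (fun σ => g (σ.map τ)) := by
  induction F using Finset.induction_on generalizing g with
  | empty => simp
  | insert e F he ih =>
    rw [Finset.map_insert, bernoulliSum_insert (by simpa using he), bernoulliSum_insert he,
      ih, ih]
    simp only [Finset.map_insert]

end BernoulliSum

section FiniteGraph

open scoped Classical

variable {V E : Type*} (s t : E → V)

/-- Adjacency in the multigraph on `V` whose edges are the elements `e` of `ω`, with
endpoints `s e` and `t e`. -/
def EdgeAdj (ω : Finset E) (a b : V) : Prop :=
  ∃ e ∈ ω, (s e = a ∧ t e = b) ∨ (s e = b ∧ t e = a)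

/-- The set of vertices connected to `B` by edges of `ω`. -/
def reach (ω : Finset E) (B : Set V) : Set V :=
  {y | ∃ x ∈ B, Relation.ReflTransGen (EdgeAdj s t ω) x y}

/-- Both endpoints of `e` lie in `A`. -/
def Inside (A : Set V) (e : E) : Prop := s e ∈ A ∧ t e ∈ A

/-- At least one endpoint of `e` lies in `A`. -/
def Touches (A : Set V) (e : E) : Prop := s e ∈ A ∨ t e ∈ A

variable {s t} {ω ω₁ ω₂ : Finset E} {A B C T : Set V} {a b x : V}

theorem EdgeAdj.symm (h : EdgeAdj s t ω a b) : EdgeAdj s t ω b a :=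
  let ⟨e, he, h⟩ := h
  ⟨e, he, h.symm⟩

theorem EdgeAdj.mono (h : ω₁ ⊆ ω₂) (hab : EdgeAdj s t ω₁ a b) : EdgeAdj s t ω₂ a b :=
  let ⟨e, he, hab⟩ := hab
  ⟨e, h he, hab⟩

theorem subset_reach : B ⊆ reach s t ω B := fun x hx => ⟨x, hx, .refl⟩

theorem reach_closed (ha : a ∈ reach s t ω B) (hab : EdgeAdj s t ω a b) : b ∈ reach s t ω B :=
  let ⟨x, hx, hxa⟩ := ha
  ⟨x, hx, hxa.tail hab⟩

theorem reach_subset (hB : B ⊆ T) (hT : ∀ a ∈ T, ∀ b, EdgeAdj s t ω a b → b ∈ T) :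
    reach s t ω B ⊆ T := by
  rintro y ⟨x, hx, hxy⟩
  induction hxy with
  | refl => exact hB hx
  | tail _ h ih => exact hT _ ih _ h

theorem reach_mono (hω : ω₁ ⊆ ω₂) : reach s t ω₁ B ⊆ reach s t ω₂ B :=
  reach_subset subset_reach fun _ ha _ hab => reach_closed ha (hab.mono hω)

theorem reach_comm : b ∈ reach s t ω {a} ↔ a ∈ reach s t ω {b} := by
  have key : ∀ a b, b ∈ reach s t ω {a} → a ∈ reach s t ω {b} := by
    rintro a b ⟨x, rfl, h⟩
    have : Std.Symm (EdgeAdj s t ω) := ⟨fun _ _ => EdgeAdj.symm⟩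
    exact ⟨b, rfl, Std.Symm.symm _ _ h⟩
  exact ⟨key _ _, key _ _⟩

theorem mem_reach_iff : a ∈ reach s t ω B ↔ ∃ b ∈ B, b ∈ reach s t ω {a} := by
  simp_rw [reach_comm (a := a)]
  simp [reach]

theorem finite_reach (hB : B.Finite) : (reach s t ω B).Finite := by
  refine (hB.union ((ω.finite_toSet.image s).union (ω.finite_toSet.image t))).subset
    (reach_subset Set.subset_union_left ?_)
  rintro a - b ⟨e, he, ⟨-, rfl⟩ | ⟨rfl, -⟩⟩
  · exact Or.inr (Or.inr ⟨e, he, rfl⟩)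
  · exact Or.inr (Or.inl ⟨e, he, rfl⟩)

theorem Touches.mono (h : A ⊆ B) {e : E} (he : Touches s t A e) : Touches s t B e :=
  he.imp (@h _) (@h _)

theorem reach_filter_inside_subset (hx : x ∈ A) :
    reach s t (ω.filter (Inside s t A)) {x} ⊆ A := by
  refine reach_subset (by simpa using hx) ?_
  rintro a - b ⟨e, he, ⟨-, rfl⟩ | ⟨rfl, -⟩⟩
  · exact (Finset.mem_filter.1 he).2.2
  · exact (Finset.mem_filter.1 he).2.1

/-- The event that the cluster of `B` is `C` only depends on the edges touching `C`. -/
theorem reach_eq_iff_of_touches (hω : ω₁ ⊆ ω) (h : ∀ e ∈ ω, Touches s t C e → e ∈ ω₁) :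
    reach s t ω B = C ↔ reach s t ω₁ B = C := by
  constructor
  · rintro rfl
    refine (reach_mono hω).antisymm fun y hy => ?_
    have : reach s t ω B ⊆ reach s t ω B ∩ reach s t ω₁ B := by
      refine reach_subset (Set.subset_inter subset_reach subset_reach) ?_
      rintro a ⟨ha, ha'⟩ b hab
      refine ⟨reach_closed ha hab, reach_closed ha' ?_⟩
      obtain ⟨e, he, hab⟩ := hab
      refine ⟨e, h e he ?_, hab⟩
      rcases hab with ⟨rfl, -⟩ | ⟨-, rfl⟩
      exacts [Or.inl ha, Or.inr ha]
    exact (this hy).2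
  · intro hC
    refine subset_antisymm (reach_subset (hC ▸ subset_reach) ?_) (hC ▸ reach_mono hω)
    rintro a ha b ⟨e, he, hab⟩
    have : e ∈ ω₁ := by
      refine h e he ?_
      rcases hab with ⟨rfl, -⟩ | ⟨-, rfl⟩
      exacts [Or.inl ha, Or.inr ha]
    rw [← hC] at ha ⊢
    exact reach_closed ha ⟨e, this, hab⟩

variable (s t) in
/-- The edges of `ω` leaving `A` from the cluster of `x` inside `A`. -/
noncomputable def exitEdges (A : Set V) (x : V) (ω : Finset E) : Finset E :=
  ω.filter fun e => ¬ Inside s t A e ∧ Touches s t (reach s t (ω.filter (Inside s t A)) {x}) e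

theorem exitEdges_mono (h : ω₁ ⊆ ω₂) : exitEdges s t A x ω₁ ⊆ exitEdges s t A x ω₂ := by
  intro e he
  simp only [exitEdges, Finset.mem_filter] at he ⊢
  exact ⟨h he.1, he.2.1, he.2.2.mono (reach_mono (Finset.filter_subset_filter _ h))⟩

variable (s t) in
/-- The endpoint outside `A` of an edge leaving `A`. -/
noncomputable def outerEnd (A : Set V) (e : E) : V := if s e ∈ A then t e else s e

theorem reach_union_subset (hx : x ∈ A)
    (h₁ : ∀ e ∈ ω₁, Touches s t (reach s t (ω₁.filter (Inside s t A)) {x}) e)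
    (h₂ : ∀ e ∈ ω₂, ¬ Touches s t (reach s t (ω₁.filter (Inside s t A)) {x}) e) :
    reach s t (ω₁ ∪ ω₂) B ⊆ reach s t (ω₁.filter (Inside s t A)) {x} ∪
      reach s t ω₂ ((B \ reach s t (ω₁.filter (Inside s t A)) {x}) ∪
        outerEnd s t A '' exitEdges s t A x ω₁) := by
  set C := reach s t (ω₁.filter (Inside s t A)) {x} with hC
  have hCA : C ⊆ A := reach_filter_inside_subset hx
  refine reach_subset (fun y hy => ?_) ?_
  · by_cases hyC : y ∈ C
    · exact Or.inl hyC
    · exact Or.inr (subset_reach (Or.inl ⟨hy, hyC⟩))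
  intro a ha b ⟨e, he, hab⟩
  by_cases hb : b ∈ C
  · exact Or.inl hb
  refine Or.inr ?_
  rcases Finset.mem_union.1 he with he | he
  · by_cases haC : a ∈ C
    · have hbA : b ∉ A := fun hbA => hb <| reach_closed haC ⟨e, by
        simp only [Finset.mem_filter, Inside]
        rcases hab with ⟨rfl, rfl⟩ | ⟨rfl, rfl⟩
        exacts [⟨he, hCA haC, hbA⟩, ⟨he, hbA, hCA haC⟩], hab⟩
      refine subset_reach (Or.inr ⟨e, ?_, ?_⟩)
      · simp only [exitEdges, Finset.coe_filter, Set.mem_ofPred_eq, ← hC, Inside, Touches]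
        rcases hab with ⟨rfl, rfl⟩ | ⟨rfl, rfl⟩ <;> tauto
      · rcases hab with ⟨rfl, rfl⟩ | ⟨rfl, rfl⟩
        · simp [outerEnd, hCA haC]
        · simp [outerEnd, hbA]
    · have := h₁ e he
      simp only [Touches] at this
      rcases hab with ⟨rfl, rfl⟩ | ⟨rfl, rfl⟩ <;> tauto
  · refine reach_closed (ha.resolve_left fun haC => h₂ e he ?_) ⟨e, he, hab⟩
    rcases hab with ⟨rfl, -⟩ | ⟨-, rfl⟩
    exacts [Or.inl haC, Or.inr haC]

theorem reach_union_eq_iff (A : Set V)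
    (h₂ : ∀ e ∈ ω₂, ¬ Touches s t C e) :
    reach s t ((ω₁ ∪ ω₂).filter (Inside s t A)) {x} = C ↔
      reach s t (ω₁.filter (Inside s t A)) {x} = C := by
  refine reach_eq_iff_of_touches (Finset.filter_subset_filter _ Finset.subset_union_left) ?_
  intro e he ht
  rw [Finset.mem_filter, Finset.mem_union] at he
  exact Finset.mem_filter.2 ⟨he.1.resolve_right fun h => h₂ e h ht, he.2⟩

/-- If the numbers of exits from suitable finite neighbourhoods are small in expectation, then
cluster sizes have exponential moments. -/
theorem bernoulliSum_pow_reach_le {p r z : ℝ} (hp : p ∈ Set.Icc (0 : ℝ) 1) (hr : 1 ≤ r)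
    (hz : 1 ≤ z) (A : V → Finset V) (hA : ∀ x, x ∈ A x)
    (hexit : ∀ x (F : Finset E),
      bernoulliSum p F (fun ω => r ^ (A x).card * z ^ (exitEdges s t (A x) x ω).card) ≤ z)
    (F : Finset E) (B : Finset V) :
    bernoulliSum p F (fun ω => r ^ (reach s t ω B).ncard) ≤ z ^ B.card := by
  induction hn : F.card + B.card using Nat.strong_induction_on generalizing F B with
  | _ n ih =>
  subst hn
  rcases B.eq_empty_or_nonempty with rfl | ⟨x, hxB⟩
  · have : ∀ ω : Finset E, reach s t ω (∅ : Set V) = ∅ := fun ω => by simp [reach]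
    simp [this, bernoulliSum_const]
  have hr0 : 0 ≤ r := zero_le_one.trans hr
  have hz0 : 0 ≤ z := zero_le_one.trans hz
  set R : Finset E → Set V := fun ω => reach s t (ω.filter (Inside s t (A x))) {x} with hR
  have hRA : ∀ ω, R ω ⊆ A x := fun ω => reach_filter_inside_subset (hA x)
  have hsum : ∀ g : Finset E → ℝ, bernoulliSum p F g =
      ∑ C ∈ (A x).powerset, bernoulliSum p F (fun ω => if R ω = C then g ω else 0) := by
    intro g
    rw [← bernoulliSum_sum]
    refine bernoulliSum_congr fun ω _ => ?_
    obtain ⟨C, hC⟩ : ∃ C : Finset V, (C : Set V) = R ω :=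
      ⟨_, ((A x).finite_toSet.subset (hRA ω)).coe_toFinset⟩
    simp_rw [← hC, Finset.coe_inj]
    rw [Finset.sum_ite_eq, if_pos]
    rw [Finset.mem_powerset, ← Finset.coe_subset, hC]
    exact hRA ω
  have hstep : ∀ C ∈ (A x).powerset,
      bernoulliSum p F (fun ω => if R ω = C then r ^ (reach s t ω B).ncard else 0) ≤
      bernoulliSum p F (fun ω => if R ω = C then
        z ^ (B.card - 1) * (r ^ (A x).card * z ^ (exitEdges s t (A x) x ω).card) else 0) := by
    intro C hC
    have hsub : F.filter (Touches s t C) ⊆ F := Finset.filter_subset _ _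
    rw [bernoulliSum_of_subset hsub, bernoulliSum_of_subset hsub]
    refine bernoulliSum_mono hp fun σ hσ => ?_
    have h₁ : ∀ e ∈ σ, Touches s t C e := fun e he => (Finset.mem_filter.1 (hσ he)).2
    have h₂ : ∀ τ ⊆ F \ F.filter (Touches s t C), ∀ e ∈ τ, ¬ Touches s t C e := by
      intro τ hτ e he ht
      have := Finset.mem_sdiff.1 (hτ he)
      exact this.2 (Finset.mem_filter.2 ⟨this.1, ht⟩)
    by_cases hσC : R σ = C
    · set B' : Finset V := (B \ C) ∪ (exitEdges s t (A x) x σ).image (outerEnd s t (A x))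
        with hB'
      have hxC : x ∈ C := by
        rw [← Finset.mem_coe, ← hσC]
        exact subset_reach rfl
      have hBC : (B \ C).card ≤ B.card - 1 := by
        rw [← Finset.card_erase_of_mem hxB]
        refine Finset.card_le_card fun y hy => ?_
        rw [Finset.mem_sdiff] at hy
        exact Finset.mem_erase.2 ⟨fun h => hy.2 (h ▸ hxC), hy.1⟩
      have hBpos : 0 < B.card := Finset.card_pos.2 ⟨x, hxB⟩
      have hcard : B'.card ≤ (B.card - 1) + (exitEdges s t (A x) x σ).card :=
        (Finset.card_union_le _ _).trans (add_le_add hBC Finset.card_image_le)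
      have hexσ : (exitEdges s t (A x) x σ).card ≤ (F.filter (Touches s t C)).card :=
        Finset.card_le_card ((Finset.filter_subset _ _).trans hσ)
      have hlt : (F \ F.filter (Touches s t C)).card + B'.card < F.card + B.card := by
        have := Finset.card_sdiff_add_card_eq_card hsub
        omega
      calc _ ≤ bernoulliSum p (F \ F.filter (Touches s t C))
              (fun τ => r ^ (A x).card * r ^ (reach s t τ B').ncard) := by
            refine bernoulliSum_mono hp fun τ hτ => ?_
            split_ifs
            · rw [← pow_add]
              refine pow_le_pow_right₀ hr ?_
              have hσC' : reach s t (σ.filter (Inside s t (A x))) {x} = C := hσC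
              have hsub' := reach_union_subset (B := B) (ω₁ := σ) (ω₂ := τ) (s := s) (t := t) (hA x)
                (by rwa [hσC']) (by rw [hσC']; exact h₂ τ hτ)
              rw [hσC'] at hsub'
              have hBB : (↑B \ ↑C ∪ outerEnd s t ↑(A x) '' ↑(exitEdges s t (↑(A x)) x σ) : Set V)
                  = B' := by
                rw [hB']; push_cast; rfl
              rw [hBB] at hsub'
              refine (Set.ncard_le_ncard hsub'
                (C.finite_toSet.union (finite_reach B'.finite_toSet))).trans
                ((Set.ncard_union_le _ _).trans (add_le_add ?_ le_rfl))
              rw [Set.ncard_coe_finset]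
              exact Finset.card_le_card (Finset.mem_powerset.1 hC)
            · positivity
        _ ≤ r ^ (A x).card * z ^ B'.card := by
            rw [bernoulliSum_const_mul]
            exact mul_le_mul_of_nonneg_left (ih _ hlt _ _ rfl) (by positivity)
        _ ≤ r ^ (A x).card * z ^ ((B.card - 1) + (exitEdges s t (A x) x σ).card) := by
            gcongr
        _ = z ^ (B.card - 1) * (r ^ (A x).card * z ^ (exitEdges s t (A x) x σ).card) := by
            rw [pow_add]; ring
        _ ≤ _ := by
            rw [← bernoulliSum_const (p := p) (F := F \ F.filter (Touches s t C))
              (z ^ (B.card - 1) * _)]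
            refine bernoulliSum_mono hp fun τ hτ => ?_
            rw [if_pos ((reach_union_eq_iff _ (h₂ τ hτ)).2 hσC)]
            have := exitEdges_mono (s := s) (t := t) (A := A x) (x := x)
              (Finset.subset_union_left : σ ⊆ σ ∪ τ)
            gcongr
    · refine (bernoulliSum_congr fun τ hτ => ?_).le
      have : ¬ R (σ ∪ τ) = C := fun h => hσC ((reach_union_eq_iff _ (h₂ τ hτ)).1 h)
      rw [if_neg this, if_neg this]
  calc _ ≤ bernoulliSum p F (fun ω =>
        z ^ (B.card - 1) * (r ^ (A x).card * z ^ (exitEdges s t (A x) x ω).card)) := by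
        rw [hsum, hsum fun ω => z ^ (B.card - 1) * _]
        exact Finset.sum_le_sum hstep
    _ ≤ z ^ (B.card - 1) * z := by
        rw [bernoulliSum_const_mul]
        exact mul_le_mul_of_nonneg_left (hexit x F) (by positivity)
    _ = z ^ B.card := by
        rw [← pow_succ, Nat.sub_add_cancel (Finset.card_pos.2 ⟨x, hxB⟩)]

theorem one_add_pow_le {y : ℝ} (h0 : 0 ≤ y) (h1 : y ≤ 1) (n : ℕ) :
    (1 + y) ^ n ≤ 1 + n * y + y ^ 2 * 4 ^ n := by
  induction n with
  | zero => simp; positivity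
  | succ n ih =>
    have h4 : (n : ℝ) ≤ 2 * 4 ^ n := by
      have : n ≤ 2 * 4 ^ n := (Nat.lt_pow_self (by norm_num : 1 < 4)).le.trans (by omega)
      exact_mod_cast this
    have h3 : y ^ 2 * (y * 4 ^ n) ≤ y ^ 2 * 4 ^ n :=
      mul_le_mul_of_nonneg_left (mul_le_of_le_one_left (by positivity) h1) (by positivity)
    have h5 := mul_le_mul_of_nonneg_left h4 (sq_nonneg y)
    rw [pow_succ, pow_succ (4 : ℝ)]
    push_cast
    nlinarith [mul_le_mul_of_nonneg_right ih (by linarith : 0 ≤ 1 + y)]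

/-- The expected number of exits through `D` from the cluster of `x` by edges in `I`. -/
noncomputable def expectedExits (s t : E → V) (p : ℝ) (I D : Finset E) (x : V) : ℝ :=
  bernoulliSum p I (fun σ => ((D.filter (Touches s t (reach s t σ {x}))).card : ℝ))

theorem bernoulliSum_pow_exitEdges_le {p δ : ℝ} (hp : p ∈ Set.Icc (0 : ℝ) 1)
    (hδ : δ ∈ Set.Icc (0 : ℝ) 1) (hx : x ∈ A) {I D : Finset E}
    (hI : ∀ e, e ∈ I ↔ Inside s t A e) (hD : ∀ e, e ∈ D ↔ Touches s t A e ∧ ¬ Inside s t A e)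
    (F : Finset E) :
    bernoulliSum p F (fun ω => (1 + δ) ^ (exitEdges s t A x ω).card) ≤
      1 + δ * (p * expectedExits s t p I D x) + δ ^ 2 * 4 ^ D.card := by
  have hID : Disjoint I D := Finset.disjoint_left.2 fun e h1 h2 => ((hD e).1 h2).2 ((hI e).1 h1)
  have hmono : Monotone fun ω => (1 + δ) ^ (exitEdges s t A x ω).card := fun ω₁ ω₂ h =>
    pow_le_pow_right₀ (by linarith [hδ.1]) (Finset.card_le_card (exitEdges_mono h))
  refine (bernoulliSum_mono_set hp (Finset.subset_union_left (s₂ := I ∪ D)) hmono).trans ?_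
  rw [bernoulliSum_marginal (h' := fun ω => (1 + δ) ^ (exitEdges s t A x ω).card)
    (Finset.subset_union_right : I ∪ D ⊆ F ∪ (I ∪ D)), bernoulliSum_union hID]
  · have hT : ∀ σ ⊆ I, bernoulliSum p D
        (fun τ => (1 + δ) ^ (exitEdges s t A x (σ ∪ τ)).card) ≤
        1 + (δ * p) * (D.filter (Touches s t (reach s t σ {x}))).card + δ ^ 2 * 4 ^ D.card := by
      intro σ hσ
      rw [bernoulliSum_marginal (h' := fun τ => (1 + δ) ^ τ.card) (Finset.filter_subset
        (Touches s t (reach s t σ {x})) D), bernoulliSum_pow_card, add_sub_cancel_left]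
      · have hpδ : p * δ ≤ δ := mul_le_of_le_one_left hδ.1 hp.2
        have hpδ0 : 0 ≤ p * δ := mul_nonneg hp.1 hδ.1
        refine (one_add_pow_le hpδ0 (hpδ.trans hδ.2) _).trans ?_
        have : (p * δ) ^ 2 * 4 ^ (D.filter (Touches s t (reach s t σ {x}))).card ≤
            δ ^ 2 * (4 : ℝ) ^ D.card := by
          gcongr
          · norm_num
          · exact Finset.filter_subset _ _
        linarith
      · intro τ hτ
        have hfil : (σ ∪ τ).filter (Inside s t A) = σ := by
          ext e
          simp only [Finset.mem_filter, Finset.mem_union, ← hI]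
          have := @hσ e
          have := @hτ e
          have : e ∈ I → e ∉ D := fun h => Finset.disjoint_left.1 hID h
          tauto
        have : exitEdges s t A x (σ ∪ τ) = τ ∩ D.filter (Touches s t (reach s t σ {x})) := by
          ext e
          rw [exitEdges, hfil]
          simp only [Finset.mem_filter, Finset.mem_inter, Finset.mem_union, ← hI]
          have := @hσ e
          have := @hτ e
          have : e ∈ I → e ∉ D := fun h => Finset.disjoint_left.1 hID h
          tauto
        rw [this]
    refine (bernoulliSum_mono hp hT).trans_eq ?_
    rw [bernoulliSum_add, bernoulliSum_add, bernoulliSum_const, bernoulliSum_const,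
      bernoulliSum_const_mul, mul_assoc]
    rfl
  · intro σ _
    have hfil : (σ ∩ (I ∪ D)).filter (Inside s t A) = σ.filter (Inside s t A) := by
      ext e
      simp only [Finset.mem_filter, Finset.mem_inter, Finset.mem_union, ← hI]
      tauto
    congr 2
    ext e
    rw [exitEdges, exitEdges, hfil]
    simp only [Finset.mem_filter, Finset.mem_inter, Finset.mem_union, hI, hD]
    have : Touches s t (reach s t (σ.filter (Inside s t A)) {x}) e → Touches s t A e :=
      fun h => h.mono (reach_filter_inside_subset hx)
    tauto

end FiniteGraph

section DifferentialInequality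

open scoped Classical

variable {V E : Type*} {s t : E → V} {ω ω₁ ω₂ : Finset E} {A B C T : Set V} {a b o x y : V}

theorem mem_reach_trans (hy : y ∈ reach s t ω B) (ho : y ∈ reach s t ω {o}) :
    o ∈ reach s t ω B :=
  reach_subset (by simpa using hy) (fun _ ha _ hab => reach_closed ha hab) (reach_comm.1 ho)

theorem expectedExits_nonneg {p : ℝ} (hp : p ∈ Set.Icc (0 : ℝ) 1) (I D : Finset E) :
    0 ≤ expectedExits s t p I D x :=
  bernoulliSum_nonneg hp fun _ _ => Nat.cast_nonneg _

theorem expectedExits_mono {p q : ℝ} (hp : p ∈ Set.Icc (0 : ℝ) 1) (hpq : p ≤ q) (hq : q ≤ 1)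
    (I D : Finset E) : expectedExits s t p I D x ≤ expectedExits s t q I D x :=
  bernoulliSum_mono_param hp hpq hq fun _ _ h => Nat.cast_le.2 <| Finset.card_le_card <|
    Finset.monotone_filter_right _ fun _ _ he => he.mono (reach_mono h)

variable (s t) in
/-- The probability that `o` is not connected to the complement of `Λ`, as a function of `p`. -/
noncomputable def stayProb (F : Finset E) (Λ : Finset V) (o : V) (p : ℝ) : ℝ :=
  bernoulliSum p F (fun ω => if o ∈ reach s t ω (Λ : Set V)ᶜ then 0 else 1)

/-- Opening a closed boundary edge of `(reach s t ω T)ᶜ` which touches the cluster of `o`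
connects `o` to `T`. -/
theorem notMem_and_mem_reach_insert {e : E} (ho : o ∉ reach s t ω T)
    (he : ¬ Inside s t (reach s t ω T)ᶜ e) (he' : Touches s t (reach s t ω {o}) e) :
    e ∉ ω ∧ o ∈ reach s t (insert e ω) T := by
  have key : ∀ a b, a ∈ reach s t ω {o} → b ∈ reach s t ω T →
      (s e = a ∧ t e = b) ∨ (s e = b ∧ t e = a) →
      e ∉ ω ∧ o ∈ reach s t (insert e ω) T := by
    intro a b ha hb hab
    have ha' : a ∉ reach s t ω T := fun h => ho (mem_reach_trans h ha)
    refine ⟨fun heω => ha' (reach_closed hb ⟨e, heω, hab.symm⟩), ?_⟩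
    have hsub := Finset.subset_insert e ω
    exact mem_reach_trans (reach_closed (reach_mono hsub hb)
      ⟨e, Finset.mem_insert_self _ _, hab.symm⟩) (reach_mono hsub ha)
  have hout : s e ∈ reach s t ω T ∨ t e ∈ reach s t ω T := by
    simp only [Inside, Set.mem_compl_iff] at he
    tauto
  rcases he' with hs | ht
  · refine key _ _ hs (hout.resolve_left fun h => ho (mem_reach_trans h hs)) (Or.inl ⟨rfl, rfl⟩)
  · refine key _ _ ht (hout.resolve_right fun h => ho (mem_reach_trans h ht)) (Or.inr ⟨rfl, rfl⟩)

theorem hasDerivAt_stayProb {p : ℝ} (hp : p ∈ Set.Icc (0 : ℝ) 1) (N : Finset V → Finset E)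
    (hN : ∀ A e, e ∈ N A ↔ Touches s t A e) (Λ : Finset V)
    (hex : ∀ A ⊆ Λ, o ∈ A → 1 ≤ p * expectedExits s t p ((N A).filter (Inside s t A))
      ((N A).filter fun e => ¬ Inside s t A e) o) :
    ∃ d, HasDerivAt (stayProb s t (N Λ) Λ o) d p ∧ stayProb s t (N Λ) Λ o p ≤ p * ((1 - p) * -d) := by
  refine ⟨_, hasDerivAt_bernoulliSum p _ _, ?_⟩
  set F := N Λ with hF
  set R : Finset E → Set V := fun ω => reach s t ω (Λ : Set V)ᶜ with hR
  set χ : Finset E → ℝ := fun ω => if o ∈ R ω then 0 else 1 with hχ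
  set K : E → Finset E → ℝ := fun e ω => if o ∉ R ω ∧ ¬ Inside s t (R ω)ᶜ e ∧
    Touches s t (reach s t (ω.filter (Inside s t (R ω)ᶜ)) {o}) e then 1 else 0 with hK
  have hRmono : Monotone R := fun ω₁ ω₂ h => reach_mono h
  have hRΛ : ∀ ω, (R ω)ᶜ ⊆ Λ := fun ω => Set.compl_subset_comm.1 subset_reach
  have hKle : ∀ e ω, K e ω ≤ if e ∈ ω then 0 else χ ω - χ (insert e ω) := by
    intro e ω
    have hins : o ∈ R ω → o ∈ R (insert e ω) := fun h => hRmono (Finset.subset_insert e ω) h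
    by_cases h : o ∉ R ω ∧ ¬ Inside s t (R ω)ᶜ e ∧
      Touches s t (reach s t (ω.filter (Inside s t (R ω)ᶜ)) {o}) e
    · obtain ⟨h1, h2⟩ := notMem_and_mem_reach_insert h.1 h.2.1
        (h.2.2.mono (reach_mono (Finset.filter_subset _ _)))
      have h2' : o ∈ R (insert e ω) := h2
      simp only [hK, hχ, if_pos h, if_neg h1, if_neg h.1, if_pos h2', sub_zero, le_refl]
    · simp only [hK, hχ, if_neg h]
      split_ifs <;> simp_all
  have hpart : ∀ g : Finset E → ℝ, bernoulliSum p F g =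
      ∑ A ∈ Λ.powerset, bernoulliSum p F (fun ω => if (R ω)ᶜ = A then g ω else 0) := by
    intro g
    rw [← bernoulliSum_sum]
    refine bernoulliSum_congr fun ω _ => ?_
    obtain ⟨A, hA⟩ : ∃ A : Finset V, (A : Set V) = (R ω)ᶜ :=
      ⟨_, (Λ.finite_toSet.subset (hRΛ ω)).coe_toFinset⟩
    simp_rw [← hA, Finset.coe_inj]
    rw [Finset.sum_ite_eq, if_pos]
    rw [Finset.mem_powerset, ← Finset.coe_subset, hA]
    exact hRΛ ω
  have hA : ∀ A ∈ Λ.powerset, bernoulliSum p F (fun ω => if (R ω)ᶜ = A then χ ω else 0) ≤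
      p * bernoulliSum p F (fun ω => if (R ω)ᶜ = A then ∑ e ∈ F, K e ω else 0) := by
    intro A hAΛ
    rw [Finset.mem_powerset] at hAΛ
    have hNA : N A ⊆ F := fun e he => (hN _ _).2 (((hN _ _).1 he).mono (by exact_mod_cast hAΛ))
    by_cases hoA : o ∈ A
    · set I := (N A).filter (Inside s t A) with hI
      set D := (N A).filter (fun e => ¬ Inside s t A e) with hD
      have hIF : I ⊆ F := (Finset.filter_subset _ _).trans hNA
      have hIin : ∀ e ∈ I, Inside s t A e := fun e he => (Finset.mem_filter.1 he).2
      have hsplit : ∀ g, bernoulliSum p F g = bernoulliSum p (F \ I) (fun σ =>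
          bernoulliSum p I fun τ => g (σ ∪ τ)) := fun g => by
        rw [bernoulliSum_of_subset (Finset.sdiff_subset : F \ I ⊆ F),
          Finset.sdiff_sdiff_eq_self hIF]
      rw [hsplit, hsplit, ← bernoulliSum_const_mul]
      refine bernoulliSum_mono hp fun σ hσ => ?_
      have hiff : ∀ τ ⊆ I, (R (σ ∪ τ))ᶜ = A ↔ (R σ)ᶜ = A := by
        intro τ hτ
        rw [compl_eq_comm, eq_comm, @compl_eq_comm _ (R σ), @eq_comm _ _ (R σ)]
        refine reach_eq_iff_of_touches Finset.subset_union_left fun e he ht => ?_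
        refine (Finset.mem_union.1 he).resolve_right fun heτ => ?_
        have := hIin e (hτ heτ)
        simp only [Touches, Inside, Set.mem_compl_iff] at ht this
        tauto
      by_cases hσA : (R σ)ᶜ = A
      · have h1 : bernoulliSum p I (fun τ => if (R (σ ∪ τ))ᶜ = A then χ (σ ∪ τ) else 0) ≤ 1 := by
          rw [← bernoulliSum_const (p := p) (F := I) 1]
          refine bernoulliSum_mono hp fun τ _ => ?_
          simp only [hχ]
          split_ifs <;> norm_num
        refine h1.trans ((hex A hAΛ hoA).trans (mul_le_mul_of_nonneg_left ?_ hp.1))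
        refine bernoulliSum_mono hp fun τ hτ => ?_
        have hτA := (hiff τ hτ).2 hσA
        rw [if_pos hτA]
        simp only [hK, hτA]
        rw [Finset.sum_boole]
        refine Nat.cast_le.2 (Finset.card_le_card fun e he => ?_)
        simp only [Finset.mem_filter] at he ⊢
        refine ⟨hNA he.1.1, ?_, he.1.2, he.2.mono (reach_mono fun e' he' => ?_)⟩
        · rw [← Set.mem_compl_iff, hτA]
          exact hoA
        · exact Finset.mem_filter.2 ⟨Finset.mem_union_right _ he', hIin _ (hτ he')⟩
      · have hz : ∀ g : Finset E → ℝ, bernoulliSum p I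
            (fun τ => if (R (σ ∪ τ))ᶜ = A then g τ else 0) = 0 := by
          intro g
          exact bernoulliSum_eq_zero fun τ hτ => if_neg fun h => hσA ((hiff τ hτ).1 h)
        rw [hz, hz, mul_zero]
    · have hz : bernoulliSum p F (fun ω => if (R ω)ᶜ = A then χ ω else 0) = 0 := by
        refine bernoulliSum_eq_zero fun ω _ => ?_
        split_ifs with h
        · refine if_pos ?_
          rw [← Finset.mem_coe, ← h] at hoA
          simpa using hoA
        · rfl
      rw [hz]
      refine mul_nonneg hp.1 (bernoulliSum_nonneg hp fun ω _ => ?_)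
      split_ifs
      · refine Finset.sum_nonneg fun e _ => ?_
        simp only [hK]
        split_ifs <;> norm_num
      · exact le_rfl
  calc stayProb s t F Λ o p = bernoulliSum p F χ := rfl
    _ ≤ p * bernoulliSum p F (fun ω => ∑ e ∈ F, K e ω) := by
      rw [hpart χ, hpart fun ω => ∑ e ∈ F, K e ω, Finset.mul_sum]
      exact Finset.sum_le_sum hA
    _ ≤ _ := by
      refine mul_le_mul_of_nonneg_left ?_ hp.1
      rw [bernoulliSum_sum, ← Finset.sum_neg_distrib, Finset.mul_sum]
      refine Finset.sum_le_sum fun e he => ?_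
      have : -bernoulliSum p (F.erase e) (fun σ => χ (insert e σ) - χ σ) =
          bernoulliSum p (F.erase e) (fun σ => χ σ - χ (insert e σ)) := by
        rw [bernoulliSum_sub, bernoulliSum_sub]; ring
      rw [this, bernoulliSum_erase_mul he]
      exact bernoulliSum_mono hp fun ω _ => hKle e ω

theorem stayProb_le {p q : ℝ} (hp : 0 < p) (hpq : p < q) (hq : q < 1)
    (N : Finset V → Finset E) (hN : ∀ A e, e ∈ N A ↔ Touches s t A e)
    (hex : ∀ A : Finset V, o ∈ A → 1 ≤ p * expectedExits s t p ((N A).filter (Inside s t A))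
      ((N A).filter fun e => ¬ Inside s t A e) o) (Λ : Finset V) :
    stayProb s t (N Λ) Λ o q ≤ p * (1 - q) / ((1 - p) * q) := by
  have hp1 : p < 1 := hpq.trans hq
  set u := stayProb s t (N Λ) Λ o with hu
  have hd : ∀ x ∈ Set.Icc p q, ∃ d, HasDerivAt u d x ∧ u x ≤ x * ((1 - x) * -d) := by
    intro x hx
    have hx01 : x ∈ Set.Icc (0 : ℝ) 1 := ⟨hp.le.trans hx.1, hx.2.trans hq.le⟩
    refine hasDerivAt_stayProb hx01 N hN Λ fun A _ hoA => (hex A hoA).trans ?_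
    exact mul_le_mul hx.1 (expectedExits_mono ⟨hp.le, hp1.le⟩ hx.1 hx01.2 _ _)
      (expectedExits_nonneg ⟨hp.le, hp1.le⟩ _ _) hx01.1
  have hanti : AntitoneOn (fun x => u x * (x / (1 - x))) (Set.Icc p q) := by
    have hder : ∀ x ∈ Set.Icc p q, ∃ d ≤ 0, HasDerivAt (fun x => u x * (x / (1 - x))) d x := by
      intro x hx
      obtain ⟨d, hd, hle⟩ := hd x hx
      have h1x : 0 < 1 - x := by linarith [hx.2]
      refine ⟨_, ?_, hd.mul ((hasDerivAt_id x).div ((hasDerivAt_id x).const_sub 1) h1x.ne')⟩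
      calc _ = (u x - x * ((1 - x) * -d)) / (1 - x) ^ 2 := by
            simp only [id]
            field_simp
            ring
        _ ≤ 0 := div_nonpos_of_nonpos_of_nonneg (sub_nonpos.2 hle) (sq_nonneg _)
    refine antitoneOn_of_deriv_nonpos (convex_Icc p q) ?_ ?_ ?_
    · intro x hx
      obtain ⟨d, -, hd⟩ := hder x hx
      exact hd.continuousAt.continuousWithinAt
    · intro x hx
      obtain ⟨d, -, hd⟩ := hder x (interior_subset hx)
      exact hd.differentiableAt.differentiableWithinAt
    · intro x hx
      obtain ⟨d, h0, hd⟩ := hder x (interior_subset hx)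
      exact hd.deriv.trans_le h0
  have h := hanti ⟨le_rfl, hpq.le⟩ ⟨hpq.le, le_rfl⟩ hpq.le
  have hup : u p ≤ 1 := by
    rw [← bernoulliSum_const (p := p) (F := N Λ) 1]
    refine bernoulliSum_mono ⟨hp.le, hp1.le⟩ fun ω _ => ?_
    split_ifs <;> norm_num
  have hp1' : 0 < 1 - p := sub_pos.2 hp1
  have hq1' : 0 < 1 - q := sub_pos.2 hq
  have hq0 : 0 < q := hp.trans hpq
  have h2 : u q * (q / (1 - q)) ≤ p / (1 - p) :=
    h.trans (mul_le_of_le_one_left (by positivity) hup)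
  calc u q = u q * (q / (1 - q)) * ((1 - q) / q) := by field_simp
    _ ≤ p / (1 - p) * ((1 - q) / q) := mul_le_mul_of_nonneg_right h2 (by positivity)
    _ = _ := by field_simp

end DifferentialInequality

section Translation

open scoped Classical

variable {V E : Type*} {s t : E → V}

theorem reach_map (φ : V ≃ V) (τ : E ≃ E) (hs : ∀ e, s (τ e) = φ (s e))
    (ht : ∀ e, t (τ e) = φ (t e)) (ω : Finset E) (x y : V) :
    φ y ∈ reach s t (ω.map τ.toEmbedding) {φ x} ↔ y ∈ reach s t ω {x} := by
  constructor
  · intro h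
    have : reach s t (ω.map τ.toEmbedding) {φ x} ⊆ φ.symm ⁻¹' reach s t ω {x} := by
      refine reach_subset ?_ ?_
      · simpa using subset_reach (Set.mem_singleton x)
      · rintro a ha b ⟨e, he, hab⟩
        obtain ⟨e', he', rfl⟩ := Finset.mem_map.1 he
        refine reach_closed ha ⟨e', he', ?_⟩
        simpa [hs, ht, Equiv.eq_symm_apply] using hab
    simpa using this h
  · intro h
    have : reach s t ω {x} ⊆ φ ⁻¹' reach s t (ω.map τ.toEmbedding) {φ x} := by
      refine reach_subset ?_ ?_
      · simpa using subset_reach (Set.mem_singleton (φ x))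
      · rintro a ha b ⟨e, he, hab⟩
        refine reach_closed ha ⟨τ e, Finset.mem_map_of_mem _ he, ?_⟩
        simpa [hs, ht] using hab
    exact this h

theorem expectedExits_map (φ : V ≃ V) (τ : E ≃ E) (hs : ∀ e, s (τ e) = φ (s e))
    (ht : ∀ e, t (τ e) = φ (t e)) (p : ℝ) (I D : Finset E) (x : V) :
    expectedExits s t p (I.map τ.toEmbedding) (D.map τ.toEmbedding) (φ x) =
      expectedExits s t p I D x := by
  rw [expectedExits, bernoulliSum_map]
  refine bernoulliSum_congr fun σ _ => ?_
  rw [Finset.filter_map, Finset.card_map]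
  congr 3
  ext e
  simp [Touches, hs, ht, reach_map φ τ hs ht]

end Translation

section Exponential

open scoped Classical

variable {G ι : Type*} [Group G]

/-- The endpoint `a * f i` of the edge `(a, i)` of the Cayley graph. -/
def edgeEnd (f : ι → G) (e : G × ι) : G := e.1 * f e.2

/-- If the expected number of open exits from a finite neighbourhood of the identity is less
than `1`, then finite-volume cluster sizes have uniformly bounded exponential moments. -/
theorem exists_bernoulliSum_pow_le (f : ι → G) {p : ℝ} (hp : p ∈ Set.Icc (0 : ℝ) 1)
    (A : Finset G) (hA : 1 ∈ A) (I D : Finset (G × ι))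
    (hI : ∀ e, e ∈ I ↔ Inside Prod.fst (edgeEnd f) A e)
    (hD : ∀ e, e ∈ D ↔ Touches Prod.fst (edgeEnd f) A e ∧ ¬ Inside Prod.fst (edgeEnd f) A e)
    (hlt : p * expectedExits Prod.fst (edgeEnd f) p I D 1 < 1) :
    ∃ r z : ℝ, 1 < r ∧ ∀ F : Finset (G × ι),
      bernoulliSum p F (fun ω => r ^ (reach Prod.fst (edgeEnd f) ω {1}).ncard) ≤ z := by
  set φ := p * expectedExits Prod.fst (edgeEnd f) p I D 1 with hφ
  have hφ0 : 0 ≤ φ := mul_nonneg hp.1 (expectedExits_nonneg hp _ _)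
  set M : ℝ := 4 ^ D.card with hM
  have hM1 : 1 ≤ M := one_le_pow₀ (by norm_num)
  have hM0 : 0 < M := by linarith
  set δ : ℝ := (1 - φ) / (2 * M) with hδ
  have hδM : δ * M = (1 - φ) / 2 := by rw [hδ]; field_simp
  have hδ0 : 0 < δ := div_pos (by linarith) (by positivity)
  have hδ1 : δ ≤ 1 := by
    rw [hδ, div_le_one (by positivity)]
    linarith
  set w : ℝ := 1 + δ * φ + δ ^ 2 * M with hw
  have hw1 : w < 1 + δ := by
    have : w = 1 + δ * φ + δ * (δ * M) := by rw [hw]; ring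
    rw [this, hδM]
    nlinarith
  obtain ⟨r, hr1, hrw⟩ : ∃ r : ℝ, 1 < r ∧ r ^ A.card * w < 1 + δ := by
    have hc : Filter.Tendsto (fun r : ℝ => r ^ A.card * w) (nhdsWithin 1 (Set.Ioi 1))
        (nhds (1 ^ A.card * w)) :=
      ((continuous_pow A.card).mul continuous_const).continuousAt.continuousWithinAt
    rw [one_pow, one_mul] at hc
    obtain ⟨r, h1, h2⟩ := ((hc.eventually_lt_const hw1).and self_mem_nhdsWithin).exists
    exact ⟨r, h2, h1⟩
  refine ⟨r, 1 + δ, hr1, fun F => ?_⟩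
  have key := bernoulliSum_pow_reach_le (s := Prod.fst) (t := edgeEnd f) (p := p) (r := r)
    (z := 1 + δ) hp hr1.le (by linarith) (fun x => A.map (Equiv.mulLeft x).toEmbedding)
    (fun x => by simpa using hA) ?_ F {1}
  · simpa using key
  intro x F
  rw [bernoulliSum_const_mul, Finset.card_map]
  refine le_trans (mul_le_mul_of_nonneg_left ?_ (by positivity)) hrw.le
  set τ : G × ι ≃ G × ι := (Equiv.mulLeft x).prodCongr (Equiv.refl ι) with hτ
  have hs : ∀ e : G × ι, (τ e).1 = Equiv.mulLeft x e.1 := fun e => rfl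
  have ht : ∀ e : G × ι, edgeEnd f (τ e) = Equiv.mulLeft x (edgeEnd f e) := fun e => by
    simp [hτ, edgeEnd, mul_assoc]
  have hmem : ∀ (K : Finset (G × ι)) e, τ e ∈ K.map τ.toEmbedding ↔ e ∈ K := fun K e => by simp
  have hin : ∀ e, Inside Prod.fst (edgeEnd f) (A.map (Equiv.mulLeft x).toEmbedding : Finset G)
      (τ e) ↔ Inside Prod.fst (edgeEnd f) A e := fun e => by simp [Inside, hs, ht]
  have hto : ∀ e, Touches Prod.fst (edgeEnd f) (A.map (Equiv.mulLeft x).toEmbedding : Finset G)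
      (τ e) ↔ Touches Prod.fst (edgeEnd f) A e := fun e => by simp [Touches, hs, ht]
  refine (bernoulliSum_pow_exitEdges_le (I := I.map τ.toEmbedding) (D := D.map τ.toEmbedding) hp
    ⟨hδ0.le, hδ1⟩ (by simpa using hA) ?_ ?_ F).trans_eq ?_
  · exact τ.surjective.forall.2 fun e => by rw [hmem, hin, hI]
  · exact τ.surjective.forall.2 fun e => by rw [hmem, hin, hto, hD]
  · have h1 : x = Equiv.mulLeft x 1 := by simp
    have h2 := expectedExits_map (Equiv.mulLeft x) τ hs ht p I D 1
    rw [← h1] at h2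
    rw [h2, Finset.card_map]

end Exponential

section Cylinder

open scoped Classical

variable {E : Type*} {p : ℝ} {μ : Measure (Config E)}

/-- The set of open edges of `ω` in `F`. -/
def openIn (F : Finset E) (ω : Config E) : Finset E := F.filter fun e => ω e = true

theorem openIn_mono {F F' : Finset E} (h : F ⊆ F') (ω : Config E) : openIn F ω ⊆ openIn F' ω :=
  Finset.filter_subset_filter _ h

theorem openIn_eq_iff {F σ : Finset E} (hσ : σ ⊆ F) (ω : Config E) :
    openIn F ω = σ ↔ ∀ e ∈ F, ω e = decide (e ∈ σ) := by
  constructor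
  · rintro rfl e he
    simp [openIn, he]
  · intro h
    ext e
    simp only [openIn, Finset.mem_filter]
    refine ⟨fun ⟨he, h'⟩ => ?_, fun he => ⟨hσ he, ?_⟩⟩
    · rw [h e he] at h'
      simpa using h'
    · rw [h e (hσ he)]
      simpa using he

theorem measurableSet_openIn_eq {F σ : Finset E} (hσ : σ ⊆ F) :
    MeasurableSet {ω : Config E | openIn F ω = σ} := by
  simp_rw [openIn_eq_iff hσ, Set.ofPred_forall]
  exact Finset.measurableSet_biInter _ fun e _ =>
    measurableSet_eq_fun (measurable_pi_apply e) measurable_const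

theorem setOf_openIn (F : Finset E) (P : Finset E → Prop) :
    {ω : Config E | P (openIn F ω)} =
      ⋃ σ ∈ F.powerset.filter P, {ω : Config E | openIn F ω = σ} := by
  ext ω
  simp [openIn]

theorem measurableSet_openIn (F : Finset E) (P : Finset E → Prop) :
    MeasurableSet {ω : Config E | P (openIn F ω)} := by
  rw [setOf_openIn]
  exact Finset.measurableSet_biUnion _ fun σ hσ =>
    measurableSet_openIn_eq (Finset.mem_powerset.1 (Finset.mem_filter.1 hσ).1)

theorem IsBernoulli.measure_openIn (hμ : IsBernoulli p μ) (hp : p ∈ Set.Icc (0 : ℝ) 1)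
    (F : Finset E) (P : Finset E → Prop) :
    μ {ω | P (openIn F ω)} =
      ENNReal.ofReal (bernoulliSum p F (fun σ => if P σ then 1 else 0)) := by
  have hp1 : 0 ≤ 1 - p := sub_nonneg.2 hp.2
  rw [setOf_openIn, measure_biUnion_finset]
  · rw [bernoulliSum, ENNReal.ofReal_sum_of_nonneg, Finset.sum_filter]
    · refine Finset.sum_congr rfl fun σ hσ => ?_
      have hσ := Finset.mem_powerset.1 hσ
      split_ifs
      · simp_rw [openIn_eq_iff hσ]
        rw [hμ, ← ENNReal.ofReal_prod_of_nonneg]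
        · simp only [decide_eq_true_eq]
          rw [Finset.prod_ite, Finset.prod_const, Finset.prod_const, mul_one,
            Finset.filter_mem_eq_inter, Finset.inter_eq_right.2 hσ, Finset.filter_notMem_eq_sdiff,
            Finset.card_sdiff_of_subset hσ]
        · intro e _
          split_ifs
          exacts [hp.1, hp1]
      · simp
    · intro σ _
      have := hp.1
      split_ifs <;> positivity
  · intro σ _ τ _ h
    exact Set.disjoint_left.2 fun ω h1 h2 => h (h1.symm.trans h2)
  · exact fun σ hσ => measurableSet_openIn_eq (Finset.mem_powerset.1 (Finset.mem_filter.1 hσ).1)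

theorem IsBernoulli.isProbabilityMeasure (hμ : IsBernoulli p μ) : IsProbabilityMeasure μ :=
  ⟨by simpa using hμ ∅ fun _ => true⟩

end Cylinder

section Cluster

open scoped Classical

variable {G ι : Type*} [Group G] {f : ι → G} {ω : Config (G × ι)}

theorem step_iff_exists_edgeAdj {a b : G} :
    Step f ω a b ↔ ∃ e, ω e = true ∧ EdgeAdj Prod.fst (edgeEnd f) {e} a b := by
  simp only [Step, EdgeAdj, edgeEnd, Finset.mem_singleton, exists_eq_left, Prod.exists]
  constructor
  · rintro ⟨i, ⟨h, rfl⟩ | ⟨h, rfl⟩⟩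
    exacts [⟨a, i, h, .inl ⟨rfl, rfl⟩⟩, ⟨b, i, h, .inr ⟨rfl, rfl⟩⟩]
  · rintro ⟨c, i, h, ⟨rfl, rfl⟩ | ⟨rfl, rfl⟩⟩
    exacts [⟨i, .inl ⟨h, rfl⟩⟩, ⟨i, .inr ⟨h, rfl⟩⟩]

theorem reach_openIn_subset_cluster (F : Finset (G × ι)) :
    reach Prod.fst (edgeEnd f) (openIn F ω) {1} ⊆ cluster f ω := by
  refine reach_subset (Set.singleton_subset_iff.2 Relation.ReflTransGen.refl) ?_
  rintro a ha b ⟨e, he, hab⟩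
  refine Relation.ReflTransGen.tail ha (step_iff_exists_edgeAdj.2 ⟨e, ?_, e, by simp, hab⟩)
  exact (Finset.mem_filter.1 he).2

theorem exists_mem_reach_openIn {x : G} (hx : x ∈ cluster f ω) :
    ∃ F, x ∈ reach Prod.fst (edgeEnd f) (openIn F ω) {1} := by
  change Relation.ReflTransGen (Step f ω) 1 x at hx
  induction hx with
  | refl => exact ⟨∅, subset_reach rfl⟩
  | tail _ hab ih =>
    obtain ⟨F, hF⟩ := ih
    obtain ⟨e, he, hab⟩ := step_iff_exists_edgeAdj.1 hab
    refine ⟨insert e F, reach_closed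
      (reach_mono (openIn_mono (Finset.subset_insert e F) ω) hF) (hab.mono ?_)⟩
    simp [openIn, he]

theorem natCast_le_encard_cluster_iff {n : ℕ} :
    (n : ℕ∞) ≤ (cluster f ω).encard ↔
      ∃ F, n ≤ (reach Prod.fst (edgeEnd f) (openIn F ω) {1}).ncard := by
  have hfin : ∀ F, (reach Prod.fst (edgeEnd f) (openIn F ω) {1}).Finite :=
    fun F => finite_reach (Set.finite_singleton 1)
  constructor
  · intro h
    obtain ⟨T, hT, hTn⟩ := Set.exists_subset_encard_eq h
    have hTf : T.Finite := Set.finite_of_encard_eq_coe hTn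
    choose! K hK using fun x (hx : x ∈ T) => exists_mem_reach_openIn (hT hx)
    refine ⟨hTf.toFinset.biUnion K, ?_⟩
    rw [← Nat.cast_le (α := ℕ∞), (hfin _).cast_ncard_eq, ← hTn]
    exact Set.encard_le_encard fun x hx => reach_mono (openIn_mono
      (Finset.subset_biUnion_of_mem K (hTf.mem_toFinset.2 hx)) ω) (hK x hx)
  · rintro ⟨F, hF⟩
    rw [← Nat.cast_le (α := ℕ∞), (hfin _).cast_ncard_eq] at hF
    exact hF.trans (Set.encard_le_encard (reach_openIn_subset_cluster F))

theorem cluster_subset_iff {Λ : Finset G} {N : Finset (G × ι)}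
    (hN : ∀ e, e ∈ N ↔ Touches Prod.fst (edgeEnd f) Λ e) :
    cluster f ω ⊆ Λ ↔ 1 ∉ reach Prod.fst (edgeEnd f) (openIn N ω) (Λ : Set G)ᶜ := by
  constructor
  · intro h h1
    obtain ⟨b, hb, h1⟩ := mem_reach_iff.1 h1
    exact hb (h (reach_openIn_subset_cluster N h1))
  · intro h x hx
    suffices x ∉ reach Prod.fst (edgeEnd f) (openIn N ω) (Λ : Set G)ᶜ by
      by_contra hxΛ
      exact this (subset_reach hxΛ)
    change Relation.ReflTransGen (Step f ω) 1 x at hx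
    induction hx with
    | refl => exact h
    | @tail a b _ hab ih =>
      intro hb
      obtain ⟨e, he, hab⟩ := step_iff_exists_edgeAdj.1 hab
      refine ih (reach_closed hb (hab.symm.mono (Finset.singleton_subset_iff.2
        (Finset.mem_filter.2 ⟨(hN e).2 ?_, he⟩))))
      have ha : a ∈ Λ := by
        by_contra haΛ
        exact ih (subset_reach haΛ)
      obtain ⟨e', he', ⟨rfl, rfl⟩ | ⟨rfl, rfl⟩⟩ := hab
      all_goals rw [Finset.mem_singleton.1 he'] at ha
      exacts [.inl ha, .inr ha]

theorem exists_finset_touches [Finite ι] (f : ι → G) (A : Finset G) :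
    ∃ N : Finset (G × ι), ∀ e, e ∈ N ↔ Touches Prod.fst (edgeEnd f) (A : Set G) e := by
  have := Fintype.ofFinite ι
  refine ⟨A ×ˢ Finset.univ ∪ (A ×ˢ Finset.univ).image fun e => (e.1 * (f e.2)⁻¹, e.2), ?_⟩
  rintro ⟨a, i⟩
  simp [Touches, edgeEnd, ← eq_mul_inv_iff_mul_eq]

theorem setOf_natCast_le_encard_cluster (f : ι → G) (n : ℕ) :
    {ω | (n : ℕ∞) ≤ (cluster f ω).encard} = ⋃ F : Finset (G × ι),
      {ω | n ≤ (reach Prod.fst (edgeEnd f) (openIn F ω) {1}).ncard} := by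
  ext ω
  simp [natCast_le_encard_cluster_iff]

theorem bddBelow_pc (f : ι → G) (μ : ℝ → Measure (Config (G × ι))) :
    BddBelow ({q | q ∈ Set.Icc (0 : ℝ) 1 ∧ 0 < theta f (μ q)} ∪ {1}) := by
  refine ⟨0, ?_⟩
  rintro q (hq | rfl)
  exacts [hq.1.1, zero_le_one]

theorem pc_le_one (f : ι → G) (μ : ℝ → Measure (Config (G × ι))) : pc f μ ≤ 1 :=
  csInf_le (bddBelow_pc f μ) (.inr rfl)

end Cluster

section Measurability

open scoped Classical

variable {G ι : Type*} [Group G] [Countable G] {f : ι → G} {p : ℝ}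
  {μ : Measure (Config (G × ι))}

theorem measurable_encard_cluster [Countable ι] (f : ι → G) :
    Measurable fun ω : Config (G × ι) => (cluster f ω).encard := by
  have hle : ∀ n : ℕ, MeasurableSet {ω : Config (G × ι) | (n : ℕ∞) ≤ (cluster f ω).encard} := by
    intro n
    rw [setOf_natCast_le_encard_cluster]
    exact MeasurableSet.iUnion fun F => measurableSet_openIn F
      fun σ => n ≤ (reach Prod.fst (edgeEnd f) σ {1}).ncard
  refine measurable_to_countable' fun x => ?_
  induction x with
  | top =>
    convert MeasurableSet.iInter hle using 1
    ext ω
    simp [ENat.eq_top_iff_forall_ge]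
  | coe n =>
    convert (hle n).diff (hle (n + 1)) using 1
    ext ω
    simp only [Set.mem_preimage, Set.mem_singleton_iff, Set.mem_sdiff, Set.mem_ofPred_eq, not_le]
    push_cast
    rw [ENat.lt_add_one_iff (ENat.natCast_ne_top n), and_comm, le_antisymm_iff]

theorem IsBernoulli.measure_le_encard_cluster_le [Countable ι] (hμ : IsBernoulli p μ)
    (hp : p ∈ Set.Icc (0 : ℝ) 1) {r z : ℝ} (hr : 1 < r)
    (h : ∀ F : Finset (G × ι),
      bernoulliSum p F (fun ω => r ^ (reach Prod.fst (edgeEnd f) ω {1}).ncard) ≤ z) (n : ℕ) :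
    μ {ω | (n : ℕ∞) ≤ (cluster f ω).encard} ≤ ENNReal.ofReal (z * r⁻¹ ^ n) := by
  rw [setOf_natCast_le_encard_cluster, Directed.measure_iUnion]
  · refine iSup_le fun F => ?_
    rw [hμ.measure_openIn hp F fun σ => n ≤ (reach Prod.fst (edgeEnd f) σ {1}).ncard]
    refine ENNReal.ofReal_le_ofReal ?_
    refine (bernoulliSum_mono hp fun σ _ => ?_).trans
      ((bernoulliSum_mul_const (r⁻¹ ^ n)).le.trans
        (mul_le_mul_of_nonneg_right (h F) (by positivity)))
    split_ifs with hn
    · rw [inv_pow, ← div_eq_mul_inv, one_le_div (by positivity)]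
      exact pow_le_pow_right₀ hr.le hn
    · positivity
  · refine directed_of_isDirected_le fun F F' hF ω hω => ?_
    exact le_trans hω (Set.ncard_le_ncard (reach_mono (openIn_mono hF ω))
      (finite_reach (Set.finite_singleton 1)))

theorem exists_stayProb_gt (hμ : IsBernoulli p μ) (hp : p ∈ Set.Icc (0 : ℝ) 1)
    (hθ : theta f μ = 0) (N : Finset G → Finset (G × ι))
    (hN : ∀ A e, e ∈ N A ↔ Touches Prod.fst (edgeEnd f) A e) {c : ℝ} (hc : c < 1) :
    ∃ Λ, c < stayProb Prod.fst (edgeEnd f) (N Λ) Λ 1 p := by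
  have := hμ.isProbabilityMeasure
  by_contra! hle
  have hsub : ∀ Λ : Finset G, μ {ω | cluster f ω ⊆ Λ} ≤ ENNReal.ofReal c := by
    intro Λ
    simp_rw [cluster_subset_iff (hN Λ)]
    rw [hμ.measure_openIn hp (N Λ) fun σ => 1 ∉ reach Prod.fst (edgeEnd f) σ (Λ : Set G)ᶜ]
    refine ENNReal.ofReal_le_ofReal ((le_of_eq ?_).trans (hle Λ))
    exact bernoulliSum_congr fun σ _ => by split_ifs <;> rfl
  have hfin : μ {ω | (cluster f ω).Finite} ≤ ENNReal.ofReal c := by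
    have : {ω | (cluster f ω).Finite} = ⋃ Λ : Finset G, {ω | cluster f ω ⊆ Λ} := by
      ext ω
      simp only [Set.mem_iUnion, Set.mem_ofPred_eq]
      exact ⟨fun h => ⟨h.toFinset, by simp⟩, fun ⟨Λ, h⟩ => Λ.finite_toSet.subset h⟩
    rw [this, Directed.measure_iUnion]
    · exact iSup_le hsub
    · exact directed_of_isDirected_le fun Λ Λ' h ω hω =>
        Set.Subset.trans hω (Finset.coe_subset.2 h)
  have hinf : μ {ω | (cluster f ω).Infinite} = 0 :=
    ((ENNReal.toReal_eq_zero_iff _).1 hθ).resolve_right (measure_ne_top _ _)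
  have h1 : (1 : ℝ≥0∞) ≤ ENNReal.ofReal c := by
    calc (1 : ℝ≥0∞) = μ Set.univ := measure_univ.symm
      _ ≤ μ ({ω | (cluster f ω).Finite} ∪ {ω | (cluster f ω).Infinite}) :=
        measure_mono fun ω _ => Set.finite_or_infinite _
      _ ≤ _ := (measure_union_le _ _).trans (by rw [hinf, add_zero]; exact hfin)
  exact absurd h1 (not_le.2 (ENNReal.ofReal_lt_one.2 hc))

/-- Below the critical probability some finite neighbourhood of the identity has expected
number of open exits less than `1`. -/
theorem exists_expectedExits_lt {f : ι → G} {μ : ℝ → Measure (Config (G × ι))}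
    (hμ : ∀ q ∈ Set.Icc (0 : ℝ) 1, IsBernoulli q (μ q)) (hp : 0 < p) (hpc : p < pc f μ)
    (N : Finset G → Finset (G × ι))
    (hN : ∀ A e, e ∈ N A ↔ Touches Prod.fst (edgeEnd f) A e) :
    ∃ A : Finset G, 1 ∈ A ∧ p * expectedExits Prod.fst (edgeEnd f) p
      ((N A).filter (Inside Prod.fst (edgeEnd f) A))
      ((N A).filter fun e => ¬ Inside Prod.fst (edgeEnd f) A e) 1 < 1 := by
  by_contra! hex
  obtain ⟨q, hpq, hq⟩ := exists_between hpc
  have hq1 : q < 1 := hq.trans_le (pc_le_one f μ)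
  have hq0 : 0 < q := hp.trans hpq
  have hqI : q ∈ Set.Icc (0 : ℝ) 1 := ⟨hq0.le, hq1.le⟩
  have hθ : theta f (μ q) = 0 := by
    refine le_antisymm (not_lt.1 fun h => ?_) ENNReal.toReal_nonneg
    exact absurd (csInf_le (bddBelow_pc f μ) (.inl ⟨hqI, h⟩)) (not_le.2 hq)
  have hc : p * (1 - q) / ((1 - p) * q) < 1 := by
    rw [div_lt_one (mul_pos (by linarith) hq0)]
    linarith
  obtain ⟨Λ, hΛ⟩ := exists_stayProb_gt (hμ q hqI) hqI hθ N hN hc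
  exact absurd (stayProb_le hp hpq hq1 N hN hex Λ) (not_le.2 hΛ)

/-- Exponential decay of the cluster size below the critical probability. -/
theorem exists_measure_le_encard_cluster_le [Finite ι] {f : ι → G}
    {μ : ℝ → Measure (Config (G × ι))}   (hμ : ∀ q ∈ Set.Icc (0 : ℝ) 1, IsBernoulli q (μ q)) (hp : 0 < p) (hpc : p < pc f μ) :
    ∃ r z : ℝ, 1 < r ∧ ∀ n : ℕ,
      μ p {ω | (n : ℕ∞) ≤ (cluster f ω).encard} ≤ ENNReal.ofReal (z * r⁻¹ ^ n) := by
  have hpI : p ∈ Set.Icc (0 : ℝ) 1 := ⟨hp.le, hpc.le.trans (pc_le_one f μ)⟩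
  choose N hN using exists_finset_touches f
  obtain ⟨A, hA, hlt⟩ := exists_expectedExits_lt hμ hp hpc N hN
  obtain ⟨r, z, hr, hz⟩ := exists_bernoulliSum_pow_le f hpI A hA _ _
    (fun e => by rw [Finset.mem_filter, hN]; exact ⟨fun h => h.2, fun h => ⟨.inl h.1, h⟩⟩)
    (fun e => by rw [Finset.mem_filter, hN]) hlt
  exact ⟨r, z, hr, (hμ p hpI).measure_le_encard_cluster_le hpI hr hz⟩

end Measurability

theorem countable_of_closure_eq_top {G : Type*} [Group G] {S : Set G} (hS : S.Countable)
    (h : Subgroup.closure S = ⊤) : Countable G := by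
  have : Countable S := hS
  have hsurj : Function.Surjective (FreeGroup.lift (Subtype.val : S → G)) := by
    rw [← MonoidHom.range_eq_top, FreeGroup.range_lift_eq_closure, Subtype.range_coe, h]
  exact hsurj.countable

section PowerSeries

variable {a : ℕ → ℝ} {z ρ : ℝ}

theorem summable_descFactorial_mul (hρ0 : 0 ≤ ρ) (hρ1 : ρ < 1) (ha : ∀ n, |a n| ≤ z * ρ ^ n)
    (k : ℕ) : Summable fun n : ℕ => (n.descFactorial k : ℝ) * a n := by
  have hs : Summable fun n : ℕ => z * ((n : ℝ) ^ k * ρ ^ n) :=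
    (summable_pow_mul_geometric_of_norm_lt_one k
      (by rwa [Real.norm_eq_abs, abs_of_nonneg hρ0])).mul_left z
  refine .of_norm_bounded hs fun n => ?_
  rw [Real.norm_eq_abs, abs_mul, Nat.abs_cast]
  calc (n.descFactorial k : ℝ) * |a n| ≤ (n : ℝ) ^ k * (z * ρ ^ n) := by
        gcongr
        exacts [mod_cast Nat.descFactorial_le_pow n k, ha n]
    _ = _ := by ring

theorem hasDerivAt_tsum_descFactorial (hρ0 : 0 < ρ) (hρ1 : ρ < 1)
    (ha : ∀ n, |a n| ≤ z * ρ ^ n) (k : ℕ) {x : ℝ} (hx : |x| ≤ 1) :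
    HasDerivAt (fun y : ℝ => ∑' n : ℕ, (n.descFactorial k : ℝ) * y ^ (n - k) * a n)
      (∑' n : ℕ, (n.descFactorial (k + 1) : ℝ) * x ^ (n - (k + 1)) * a n) x := by
  obtain ⟨R, hR1, hR⟩ := exists_between (one_lt_inv₀ hρ0 |>.2 hρ1)
  have hR0 : 0 < R := by linarith
  have hRρ : R * ρ < 1 := by rwa [← lt_div_iff₀ hρ0, one_div]
  have hb : ∀ n, abs (R ^ n * |a n|) ≤ z * (R * ρ) ^ n := fun n => by
    rw [abs_of_nonneg (by positivity), mul_pow]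
    calc R ^ n * |a n| ≤ R ^ n * (z * ρ ^ n) := by gcongr; exact ha n
      _ = _ := by ring
  have hs := fun k => summable_descFactorial_mul (by positivity) hRρ hb k
  have hbd : ∀ (k n : ℕ) (y : ℝ), y ∈ Metric.ball (0 : ℝ) R →
      ‖(n.descFactorial k : ℝ) * y ^ (n - k) * a n‖ ≤
        (n.descFactorial k : ℝ) * (R ^ n * |a n|) := by
    intro k n y hy
    rw [mem_ball_zero_iff, Real.norm_eq_abs] at hy
    rw [Real.norm_eq_abs, abs_mul, abs_mul, abs_pow, Nat.abs_cast, mul_assoc]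
    have : |y| ^ (n - k) ≤ R ^ n := (pow_le_pow_left₀ (abs_nonneg y) hy.le _).trans
      (pow_le_pow_right₀ hR1.le (Nat.sub_le n k))
    gcongr
  have hxR : x ∈ Metric.ball (0 : ℝ) R := by
    rw [mem_ball_zero_iff, Real.norm_eq_abs]
    exact hx.trans_lt hR1
  refine hasDerivAt_tsum_of_isPreconnected (hs (k + 1)) Metric.isOpen_ball
    (convex_ball (0 : ℝ) R).isPreconnected (fun n y _ => ?_) (hbd (k + 1)) hxR
    (.of_norm_bounded (hs k) fun n => hbd k n x hxR) hxR
  have := ((hasDerivAt_pow (n - k) y).const_mul (n.descFactorial k : ℝ)).mul_const (a n)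
  refine this.congr_deriv ?_
  rw [Nat.descFactorial_succ, Nat.sub_sub]
  push_cast
  ring

theorem iteratedDerivWithin_one_sub_tsum (hρ0 : 0 < ρ) (hρ1 : ρ < 1)
    (ha : ∀ n, |a n| ≤ z * ρ ^ n) (k : ℕ) {t : ℝ} (ht : t ∈ Set.Icc (0 : ℝ) 1) :
    iteratedDerivWithin (k + 1) (fun t : ℝ => 1 - ∑' n : ℕ, (1 - t) ^ n * a n)
      (Set.Icc (0 : ℝ) 1) t =
      (-1) ^ k * ∑' n : ℕ, (n.descFactorial (k + 1) : ℝ) * (1 - t) ^ (n - (k + 1)) * a n := by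
  have hd : ∀ (j : ℕ) {t : ℝ}, t ∈ Set.Icc (0 : ℝ) 1 →
      HasDerivAt (fun y : ℝ => ∑' n : ℕ, (n.descFactorial j : ℝ) * (1 - y) ^ (n - j) * a n)
        (-∑' n : ℕ, (n.descFactorial (j + 1) : ℝ) * (1 - t) ^ (n - (j + 1)) * a n) t :=
    fun j t ht => (hasDerivAt_tsum_descFactorial hρ0 hρ1 ha j
      (abs_le.2 ⟨by linarith [ht.2], by linarith [ht.1]⟩)).comp_const_sub 1 t
  have hu : UniqueDiffOn ℝ (Set.Icc (0 : ℝ) 1) := uniqueDiffOn_Icc zero_lt_one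
  induction k generalizing t with
  | zero =>
    have h0 := (hd 0 ht).const_sub 1
    simp only [Nat.descFactorial_zero, Nat.cast_one, one_mul, Nat.sub_zero, neg_neg] at h0
    rw [zero_add, iteratedDerivWithin_one, pow_zero, one_mul]
    exact h0.hasDerivWithinAt.derivWithin (hu t ht)
  | succ k ih =>
    rw [iteratedDerivWithin_succ, derivWithin_congr (fun y hy => ih hy) (ih ht),
      ((hd (k + 1) ht).const_mul ((-1) ^ k)).hasDerivWithinAt.derivWithin (hu t ht)]
    ring

end PowerSeries

theorem prod_range_sub_one_sub (n k : ℕ) :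
    ∏ j ∈ Finset.range k, (n - 1 - j) = (n - 1).descFactorial k :=
  (Nat.descFactorial_eq_prod_range _ _).symm

theorem lintegral_comp_enat {Ω : Type*} [MeasurableSpace Ω] {μ : Measure Ω} {X : Ω → ℕ∞}
    (hX : Measurable X) (htop : μ {ω | X ω = ⊤} = 0) (g : ℕ∞ → ℝ≥0∞) :
    ∫⁻ ω, g (X ω) ∂μ = ∑' n : ℕ, g n * μ {ω | X ω = n} := by
  have hmap : ∀ x, μ.map X {x} = μ {ω | X ω = x} := fun x =>
    Measure.map_apply hX (measurableSet_singleton x)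
  rw [← lintegral_map (measurable_of_countable g) hX, lintegral_countable']
  simp_rw [hmap]
  refine (Function.Injective.tsum_eq Nat.cast_injective fun x hx => ?_).symm
  induction x with
  | top => exact absurd (by simp [htop]) hx
  | coe n => exact ⟨n, rfl⟩

end Perc

open Perc


/-- For `0 < p < p_c` and `k ≥ 1`, the sum
`∑_{n≥k+1} (n-1)⋯(n-k)·P_p(|C| = n)` is finite, the `k`-th one-sided derivative of
`t ↦ g(p,t)` at `t = 0` (within `[0,1]`) equals `(-1)^{k+1}` times it, and it equals
`E_p[(|C|-1)⋯(|C|-k)]`.  (The factor `(n-1)⋯(n-k) = ∏_{j<k} (n-1-j)` vanishes for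
`n ≤ k`, so the sum over all `n` is the sum over `n ≥ k+1`.) -/
theorem walk_through_iterated_deriv
    {G : Type*} [Group G] (S : Set G) (hfin : S.Finite)
    (hgen : Subgroup.closure S = ⊤)
    (μ : ℝ → Measure (Config (G × S)))
    (hμ : ∀ q ∈ Set.Icc (0 : ℝ) 1, IsBernoulli q (μ q))
    (p : ℝ) (hp0 : 0 < p) (hppc : p < pc (setGens S) μ) (k : ℕ) (hk : 1 ≤ k) :
    (∑' n : ℕ, ((∏ j ∈ Finset.range k, (n - 1 - j) : ℕ) : ℝ≥0∞)
        * μ p {ω | (cluster (setGens S) ω).encard = (n : ℕ∞)}) ≠ ⊤ ∧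
    iteratedDerivWithin k (wt (setGens S) (μ p)) (Set.Icc (0 : ℝ) 1) 0
      = (-1 : ℝ) ^ (k + 1) *
        (∑' n : ℕ, ((∏ j ∈ Finset.range k, (n - 1 - j) : ℕ) : ℝ≥0∞)
          * μ p {ω | (cluster (setGens S) ω).encard = (n : ℕ∞)}).toReal ∧
    (∑' n : ℕ, ((∏ j ∈ Finset.range k, (n - 1 - j) : ℕ) : ℝ≥0∞)
        * μ p {ω | (cluster (setGens S) ω).encard = (n : ℕ∞)})
      = ∫⁻ ω, ((∏ j ∈ Finset.range k,
          ((cluster (setGens S) ω).encard - 1 - (j : ℕ∞)) : ℕ∞) : ℝ≥0∞) ∂(μ p) := by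
  have : Countable G := countable_of_closure_eq_top hfin.countable hgen
  have : Finite S := hfin
  obtain ⟨r, z, hr, hz⟩ := exists_measure_le_encard_cluster_le hμ hp0 hppc
  have hr0 : 0 < r := zero_lt_one.trans hr
  have hρ1 : r⁻¹ < 1 := inv_lt_one_of_one_lt₀ hr
  have htop : μ p {ω | (cluster (setGens S) ω).encard = ⊤} = 0 := by
    have hlim : Filter.Tendsto (fun n : ℕ => ENNReal.ofReal (z * r⁻¹ ^ n)) Filter.atTop
        (nhds 0) := by
      have := (tendsto_pow_atTop_nhds_zero_of_lt_one (inv_nonneg.2 hr0.le) hρ1).const_mul z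
      rw [mul_zero] at this
      simpa using ENNReal.tendsto_ofReal this
    exact le_antisymm (ge_of_tendsto' hlim fun n =>
      (measure_mono fun ω hω => le_of_le_of_eq le_top hω.symm).trans (hz n)) zero_le
  set b : ℕ → ℝ≥0∞ :=
    fun n => μ p {ω | (cluster (setGens S) ω).encard = ((n + 1 : ℕ) : ℕ∞)} with hb
  have hble : ∀ n, b n ≤ ENNReal.ofReal (z * r⁻¹ ^ (n + 1)) := fun n =>
    (measure_mono fun ω hω => hω.ge).trans (hz (n + 1))
  have hbtop : ∀ n, b n ≠ ⊤ := fun n => ne_top_of_le_ne_top ENNReal.ofReal_ne_top (hble n)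
  have hz0 : 0 ≤ z := by
    have := (hμ p ⟨hp0.le, hppc.le.trans (pc_le_one _ _)⟩).isProbabilityMeasure
    have h0 := hz 0
    simp only [Nat.cast_zero, zero_le, Set.ofPred_true, measure_univ, pow_zero, mul_one,
      ENNReal.one_le_ofReal] at h0
    exact zero_le_one.trans h0
  have ha : ∀ n, |(b n).toReal| ≤ z * r⁻¹ * r⁻¹ ^ n := fun n => by
    rw [abs_of_nonneg ENNReal.toReal_nonneg, mul_assoc, ← pow_succ']
    exact ENNReal.toReal_le_of_le_ofReal (by positivity) (hble n)
  obtain ⟨m, rfl⟩ : ∃ m, k = m + 1 := ⟨k - 1, by omega⟩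
  have hsum : (∑' n : ℕ, ((∏ j ∈ Finset.range (m + 1), (n - 1 - j) : ℕ) : ℝ≥0∞)
        * μ p {ω | (cluster (setGens S) ω).encard = (n : ℕ∞)}) =
      ∑' n : ℕ, (n.descFactorial (m + 1) : ℝ≥0∞) * b n := by
    simp_rw [prod_range_sub_one_sub]
    rw [tsum_eq_zero_add' ENNReal.summable]
    simp only [Nat.zero_sub, Nat.zero_descFactorial_succ, Nat.cast_zero,
      zero_mul, zero_add, Nat.add_sub_cancel, hb]
  have hterm : ∀ n : ℕ, ((n.descFactorial (m + 1) : ℝ≥0∞) * b n).toReal =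
      (n.descFactorial (m + 1) : ℝ) * (b n).toReal := fun n => by
    rw [ENNReal.toReal_mul, ENNReal.toReal_natCast]
  have htermtop : ∀ n : ℕ, (n.descFactorial (m + 1) : ℝ≥0∞) * b n ≠ ⊤ :=
    fun n => ENNReal.mul_ne_top (ENNReal.natCast_ne_top _) (hbtop n)
  refine ⟨?_, ?_, ?_⟩
  · rw [hsum]
    have := (summable_descFactorial_mul (inv_nonneg.2 hr0.le) hρ1 ha (m + 1)).tsum_ofReal_ne_top
    simpa only [← hterm, ENNReal.ofReal_toReal (htermtop _)] using this
  · rw [hsum, ENNReal.tsum_toReal_eq htermtop]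
    refine (iteratedDerivWithin_one_sub_tsum (inv_pos.2 hr0) hρ1 ha m
      (Set.left_mem_Icc.2 zero_le_one)).trans ?_
    simp only [hterm, sub_zero, one_pow, mul_one]
    ring
  · rw [lintegral_comp_enat (measurable_encard_cluster (setGens S)) htop
      fun x => ((∏ j ∈ Finset.range (m + 1), (x - 1 - (j : ℕ∞)) : ℕ∞) : ℝ≥0∞)]
    refine tsum_congr fun n => ?_
    congr 1
    rw [← ENat.toENNReal_coe]
    push_cast
    rfl
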